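/- arXiv:0810.2235 — 4 statements merged into one kernel-verified Lean document; each statement's English description precedes it below -/
import Mathlib

section
/- For every ε_0 ∈ (0, 1) there exist constants c > 0 and T_0 ≥ 1 such that for every real T ≥ T_0 the following holds: setting N* = ⌊exp(exp(c T² / log T))⌋, there exists an integer U with N* < U ≤ 2 N* such that ‖U √q − 1/2‖ ≤ ε_0 / T simultaneously for every squarefree integer q with 1 < q ≤ T². -/
theorem Nat.not_isSquare_mul_of_squarefree_of_ne {a b : ℕ} (ha : Squarefree a) (hb : Squarefree b)
    (hab : a ≠ b) : ¬ IsSquare (a * b) := by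
  rintro ⟨c, hc⟩
  have hac : a ∣ c := (ha.dvd_pow_iff_dvd two_ne_zero).1
    ⟨b, by rw [sq, hc]⟩
  obtain ⟨d, rfl⟩ := hac
  have hbd : b = d * d * a :=
    Nat.eq_of_mul_eq_mul_left (Nat.pos_of_ne_zero ha.ne_zero) (by linarith)
  have hd : d = 1 := Nat.isUnit_iff.1 (hb d ⟨a, hbd⟩)
  exact hab (by simp [hbd, hd])

theorem Algebra.normalizedTrace_eq_zero_of_sq_eq_natCast {K : Type*} [Field K] [Algebra ℚ K]
    [Algebra.IsIntegral ℚ K] {n : ℕ} (hn : ¬ IsSquare n) {x : K} (hx : x ^ 2 = n) :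
    Algebra.normalizedTrace ℚ K x = 0 := by
  have hirr : Irreducible (Polynomial.X ^ 2 - Polynomial.C (n : ℚ)) := by
    refine X_pow_sub_C_irreducible_of_prime Nat.prime_two fun b hb => hn ?_
    exact Rat.isSquare_natCast_iff.1 ⟨b, by rw [← hb, sq]⟩
  have hmin : Polynomial.X ^ 2 - Polynomial.C (n : ℚ) = minpoly ℚ x :=
    minpoly.eq_of_irreducible_of_monic hirr (by simp [hx])
      (Polynomial.monic_X_pow_sub_C _ two_ne_zero)
  rw [Algebra.normalizedTrace_minpoly, ← hmin, Polynomial.nextCoeff_of_natDegree_pos]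
  · rw [Polynomial.natDegree_X_pow_sub_C]
    simp
  · rw [Polynomial.natDegree_X_pow_sub_C]
    exact two_pos

theorem Real.eq_zero_of_sum_mul_sqrt_eq_zero {S : Finset ℕ} (hS : ∀ q ∈ S, Squarefree q)
    {m : ℕ → ℤ} (h : ∑ q ∈ S, (m q : ℝ) * √(q : ℝ) = 0) {r : ℕ} (hr : r ∈ S) : m r = 0 := by
  have hint (n : ℕ) : √(n : ℝ) ∈ algebraicClosure ℚ ℝ := by
    refine mem_algebraicClosure_iff.2 (IsAlgebraic.of_pow two_pos ?_)
    rw [Real.sq_sqrt n.cast_nonneg]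
    exact isAlgebraic_natCast n
  let s (n : ℕ) : algebraicClosure ℚ ℝ := ⟨√(n : ℝ), hint n⟩
  have hs (n : ℕ) : s n ^ 2 = n := Subtype.ext (by simp [s])
  have hmul (a b : ℕ) : s a * s b = s (a * b) := Subtype.ext (by simp [s])
  have hsum : ∑ q ∈ S, (m q : ℚ) • s (q * r) = 0 := by
    have : ∑ q ∈ S, (m q : ℚ) • s q = 0 := Subtype.ext (by simpa [s, Algebra.smul_def] using h)
    have h2 := congrArg (· * s r) this
    simpa only [Finset.sum_mul, smul_mul_assoc, hmul, zero_mul] using h2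
  have : Algebra.IsIntegral ℚ (algebraicClosure ℚ ℝ) :=
    (algebraicClosure.isAlgebraic ℚ ℝ).isIntegral
  have htr := congrArg (Algebra.normalizedTrace ℚ (algebraicClosure ℚ ℝ)) hsum
  rw [map_sum, map_zero, Finset.sum_eq_single_of_mem r hr] at htr
  · have hrr : s (r * r) = algebraMap ℚ _ (r : ℚ) := by rw [← hmul, ← sq, hs]; simp
    rw [map_smul, hrr, Algebra.normalizedTrace_algebraMap_apply_eq_self] at htr
    simpa [(hS r hr).ne_zero] using htr
  · intro q hq hqr
    rw [map_smul, Algebra.normalizedTrace_eq_zero_of_sq_eq_natCast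
      (Nat.not_isSquare_mul_of_squarefree_of_ne (hS q hq) (hS r hr) hqr) (hs _), smul_zero]

/-- `IsSqrtCombination l H x` says that `x` is an integral linear combination of products of square
roots of distinct entries of `l`, and that the sum of the absolute values of its terms is at
most `H`. -/
def IsSqrtCombination : List ℕ → ℝ → ℝ → Prop
  | [], H, x => ∃ n : ℤ, x = n ∧ |x| ≤ H
  | p :: l, H, x => ∃ y z A B : ℝ, IsSqrtCombination l A y ∧ IsSqrtCombination l B z ∧
      x = y + √(p : ℝ) * z ∧ A + √(p : ℝ) * B ≤ H

namespace IsSqrtCombination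

variable {l : List ℕ} {H H₁ H₂ x y : ℝ}

theorem abs_le (h : IsSqrtCombination l H x) : |x| ≤ H := by
  induction l generalizing H x with
  | nil => obtain ⟨n, -, h⟩ := h; exact h
  | cons p l ih =>
    obtain ⟨y, z, A, B, hy, hz, rfl, hH⟩ := h
    calc |y + √(p : ℝ) * z| ≤ |y| + √(p : ℝ) * |z| := by
          grw [abs_add_le, abs_mul, abs_of_nonneg (Real.sqrt_nonneg _)]
      _ ≤ A + √(p : ℝ) * B := by grw [ih hy, ih hz]
      _ ≤ H := hH

theorem nonneg (h : IsSqrtCombination l H x) : 0 ≤ H := (abs_nonneg x).trans h.abs_le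

theorem mono (h : IsSqrtCombination l H₁ x) (hH : H₁ ≤ H₂) : IsSqrtCombination l H₂ x := by
  cases l with
  | nil => obtain ⟨n, hn, h⟩ := h; exact ⟨n, hn, h.trans hH⟩
  | cons p l =>
    obtain ⟨y, z, A, B, hy, hz, hx, hA⟩ := h
    exact ⟨y, z, A, B, hy, hz, hx, hA.trans hH⟩

theorem intCast (l : List ℕ) (n : ℤ) : IsSqrtCombination l |(n : ℝ)| n := by
  induction l generalizing n with
  | nil => exact ⟨n, rfl, le_rfl⟩
  | cons p l ih => exact ⟨n, (0 : ℤ), |(n : ℝ)|, |((0 : ℤ) : ℝ)|, ih n, ih 0, by simp, by simp⟩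

theorem add (hx : IsSqrtCombination l H₁ x) (hy : IsSqrtCombination l H₂ y) :
    IsSqrtCombination l (H₁ + H₂) (x + y) := by
  induction l generalizing H₁ H₂ x y with
  | nil =>
    obtain ⟨m, rfl, hm⟩ := hx
    obtain ⟨n, rfl, hn⟩ := hy
    exact ⟨m + n, by simp, (abs_add_le _ _).trans (add_le_add hm hn)⟩
  | cons p l ih =>
    obtain ⟨u, v, A, B, hu, hv, rfl, hA⟩ := hx
    obtain ⟨w, z, C, D, hw, hz, rfl, hC⟩ := hy
    exact ⟨u + w, v + z, A + C, B + D, ih hu hw, ih hv hz, by ring, by linarith⟩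

theorem mul (hx : IsSqrtCombination l H₁ x) (hy : IsSqrtCombination l H₂ y) :
    IsSqrtCombination l (H₁ * H₂) (x * y) := by
  have hx₀ := hx.nonneg
  induction l generalizing H₁ H₂ x y with
  | nil =>
    obtain ⟨m, rfl, hm⟩ := hx
    obtain ⟨n, rfl, hn⟩ := hy
    exact ⟨m * n, by simp, by rw [abs_mul]; exact mul_le_mul hm hn (abs_nonneg _) hx₀⟩
  | cons p l ih =>
    obtain ⟨u, v, A, B, hu, hv, rfl, hA⟩ := hx
    obtain ⟨w, z, C, D, hw, hz, rfl, hC⟩ := hy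
    have hA₀ := hu.nonneg
    have hB₀ := hv.nonneg
    have hC₀ := hw.nonneg
    have hD₀ := hz.nonneg
    have hp : √(p : ℝ) * √(p : ℝ) = p := Real.mul_self_sqrt p.cast_nonneg
    have hpv : IsSqrtCombination l (p * (B * D)) (p * (v * z)) := by
      simpa using ih (intCast l p) (ih hv hz hv.nonneg) (abs_nonneg _)
    refine ⟨u * w + p * (v * z), u * z + v * w, A * C + p * (B * D), A * D + B * C,
      (ih hu hw hA₀).add hpv, (ih hu hz hA₀).add (ih hv hw hB₀),
      by linear_combination (v * z) * hp, ?_⟩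
    calc A * C + p * (B * D) + √(p : ℝ) * (A * D + B * C)
        = (A + √(p : ℝ) * B) * (C + √(p : ℝ) * D) := by
          linear_combination -(B * D) * hp
      _ ≤ H₁ * H₂ := by gcongr

theorem le_pow_mul_abs (h : IsSqrtCombination l H x) (hH : 1 ≤ H) (hx : x ≠ 0) :
    H ≤ H ^ 2 ^ l.length * |x| := by
  induction l generalizing H x with
  | nil =>
    obtain ⟨n, rfl, -⟩ := h
    have hn : 1 ≤ |(n : ℝ)| := by
      exact_mod_cast Int.one_le_abs (by exact_mod_cast hx)
    simpa using le_mul_of_one_le_right (zero_le_one.trans hH) hn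
  | cons p l ih =>
    obtain ⟨y, z, A, B, hy, hz, rfl, hA⟩ := h
    have hA₀ := hy.nonneg
    have hB₀ := hz.nonneg
    have hp₀ := Real.sqrt_nonneg (p : ℝ)
    have hp : √(p : ℝ) * √(p : ℝ) = p := Real.mul_self_sqrt p.cast_nonneg
    rw [List.length_cons]
    by_cases hconj : y - √(p : ℝ) * z = 0
    · have hz' : √(p : ℝ) * z = y := (sub_eq_zero.1 hconj).symm
      rw [hz'] at hx ⊢
      have hy0 : y ≠ 0 := fun h => hx (by rw [h, add_zero])
      have hyx : |y| ≤ |y + y| := by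
        rw [← two_mul, abs_mul, abs_two]; linarith [abs_nonneg y]
      calc H ≤ H ^ 2 ^ l.length * |y| := ih (hy.mono (by nlinarith)) hH hy0
        _ ≤ H ^ 2 ^ (l.length + 1) * |y + y| := by gcongr <;> simp
    · have hw : IsSqrtCombination l (H ^ 2) ((y + √(p : ℝ) * z) * (y - √(p : ℝ) * z)) := by
        have h1 := (hy.mul hy).add ((intCast l (-p)).mul (hz.mul hz))
        have h2 : (y + √(p : ℝ) * z) * (y - √(p : ℝ) * z) = y * y + ((-p : ℤ) : ℝ) * (z * z) := by
          push_cast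
          linear_combination -(z * z) * hp
        rw [h2]
        refine h1.mono ?_
        have : |((-p : ℤ) : ℝ)| = p := by simp
        rw [this]
        calc A * A + p * (B * B) ≤ (A + √(p : ℝ) * B) ^ 2 := by
              nlinarith [mul_nonneg (mul_nonneg hA₀ hp₀) hB₀]
          _ ≤ H ^ 2 := by gcongr
      have hconj_le : |y - √(p : ℝ) * z| ≤ H := by
        calc |y - √(p : ℝ) * z| ≤ |y| + √(p : ℝ) * |z| := by
              grw [abs_sub, abs_mul, abs_of_nonneg hp₀]
          _ ≤ A + √(p : ℝ) * B := by grw [hy.abs_le, hz.abs_le]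
          _ ≤ H := hA
      have hih := ih hw (one_le_pow₀ hH) (mul_ne_zero hx hconj)
      rw [abs_mul, ← pow_mul, ← pow_succ', ← mul_assoc] at hih
      have h3 : H * H ≤ H ^ 2 ^ (l.length + 1) * |y + √(p : ℝ) * z| * H := by
        rw [← sq]
        exact hih.trans (by gcongr)
      exact le_of_mul_le_mul_right h3 (by linarith)

theorem sqrt_of_mem {p : ℕ} (hp : p ∈ l) : IsSqrtCombination l √(p : ℝ) √(p : ℝ) := by
  induction l with
  | nil => simp at hp
  | cons r l ih =>
    have h0 : IsSqrtCombination l 0 0 := by simpa using intCast l 0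
    have h1 : IsSqrtCombination l 1 1 := by simpa using intCast l 1
    obtain rfl | hp := List.mem_cons.1 hp
    · exact ⟨0, 1, 0, 1, h0, h1, by simp, by simp⟩
    · exact ⟨_, 0, _, 0, ih hp, h0, by simp, by simp⟩

theorem sqrt_natCast {n : ℕ} (hn : n ≠ 0) (hl : ∀ p, p.Prime → p ∣ n → p ∈ l) :
    IsSqrtCombination l √(n : ℝ) √(n : ℝ) := by
  induction n using Nat.recOnMul with
  | zero => simp at hn
  | one => simpa using intCast l 1
  | prime p hp => exact sqrt_of_mem (hl p hp dvd_rfl)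
  | mul a b iha ihb =>
    rw [mul_ne_zero_iff] at hn
    have ha := iha hn.1 fun p hp h => hl p hp (h.mul_right b)
    have hb := ihb hn.2 fun p hp h => hl p hp (h.mul_left a)
    simpa using ha.mul hb

theorem sum {ι : Type*} {S : Finset ι} {f g : ι → ℝ}
    (h : ∀ i ∈ S, IsSqrtCombination l (f i) (g i)) :
    IsSqrtCombination l (∑ i ∈ S, f i) (∑ i ∈ S, g i) := by
  classical
  induction S using Finset.induction_on with
  | empty => simpa using intCast l 0
  | insert a S ha ih =>
    rw [Finset.sum_insert ha, Finset.sum_insert ha]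
    exact (h a (Finset.mem_insert_self a S)).add
      (ih fun i hi => h i (Finset.mem_insert_of_mem hi))

end IsSqrtCombination

theorem Real.one_le_pow_mul_abs_sum_sqrt_sub_round {S : Finset ℕ} {X M : ℕ}
    (hS : ∀ q ∈ S, Squarefree q ∧ 1 < q ∧ q ≤ X) {m : ℕ → ℤ} (hm : ∀ q ∈ S, |m q| ≤ M)
    (hm0 : ∃ q ∈ S, m q ≠ 0) :
    1 ≤ (1 + 2 * M * X ^ 2 : ℝ) ^ 2 ^ Nat.primeCounting X *
      |∑ q ∈ S, (m q : ℝ) * √(q : ℝ) - round (∑ q ∈ S, (m q : ℝ) * √(q : ℝ))| := by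
  set a := ∑ q ∈ S, (m q : ℝ) * √(q : ℝ) with ha
  have hne : a + ((-round a : ℤ) : ℝ) ≠ 0 := by
    intro h
    have h1S : 1 ∉ S := fun h => absurd (hS 1 h).2.1 (lt_irrefl 1)
    obtain ⟨r, hr, hr0⟩ := hm0
    refine hr0 ?_
    have hr1 : r ≠ 1 := fun h => h1S (h ▸ hr)
    have hsum : ∑ q ∈ insert 1 S, (Function.update m 1 (-round a) q : ℝ) * √(q : ℝ) = 0 := by
      rw [Finset.sum_insert h1S, ← h, ha, add_comm]
      congr 1
      · refine Finset.sum_congr rfl fun q hq => ?_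
        rw [Function.update_of_ne fun h => h1S (by rwa [← h])]
      · simp
    have := Real.eq_zero_of_sum_mul_sqrt_eq_zero (fun q hq => ?_) hsum
      (Finset.mem_insert_of_mem hr)
    · rwa [Function.update_of_ne hr1] at this
    · obtain rfl | hq := Finset.mem_insert.1 hq
      exacts [squarefree_one, (hS q hq).1]
  have hcard : S.card ≤ X := by
    refine (Finset.card_le_card (t := Finset.Ioc 0 X) fun q hq => ?_).trans (by simp)
    have := hS q hq
    exact Finset.mem_Ioc.2 ⟨by omega, this.2.2⟩
  have hcomb : IsSqrtCombination (Nat.primesLE X).toList (M * X ^ 2) a := by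
    refine (IsSqrtCombination.sum (f := fun _ => (M * X : ℝ)) fun q hq => ?_).mono ?_
    · have hq' := hS q hq
      refine ((IsSqrtCombination.intCast _ (m q)).mul (IsSqrtCombination.sqrt_natCast (n := q)
        hq'.1.ne_zero fun p hp hpq => ?_)).mono ?_
      · have := Nat.le_of_dvd (by omega) hpq
        exact Finset.mem_toList.2 (Nat.mem_primesLE.2 ⟨by omega, hp⟩)
      · have h1 : |(m q : ℝ)| ≤ M := by exact_mod_cast hm q hq
        have h2 : √(q : ℝ) ≤ X := by
          refine Real.sqrt_le_iff.2 ⟨by positivity, ?_⟩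
          have : q ≤ X ^ 2 := hq'.2.2.trans (Nat.le_self_pow two_ne_zero X)
          exact_mod_cast this
        gcongr
    · rw [Finset.sum_const, nsmul_eq_mul]
      have : (S.card : ℝ) ≤ X := by exact_mod_cast hcard
      calc (S.card : ℝ) * (M * X) ≤ X * (M * X) := by gcongr
        _ = M * X ^ 2 := by ring
  have hround : |((-round a : ℤ) : ℝ)| ≤ 1 + M * X ^ 2 := by
    have h1 := abs_sub_round a
    have h2 := hcomb.abs_le
    rw [abs_le] at *
    push_cast
    constructor <;> linarith [h1.1, h1.2, h2.1, h2.2]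
  have hH : (1 : ℝ) ≤ 1 + 2 * M * X ^ 2 := le_add_of_nonneg_right (by positivity)
  have hfin := ((hcomb.add (IsSqrtCombination.intCast _ (-round a))).mono
    (H₂ := 1 + 2 * M * X ^ 2) (by linarith)).le_pow_mul_abs hH hne
  rw [Finset.length_toList, Nat.primesLE_card_eq_primeCounting] at hfin
  simpa [sub_eq_add_neg] using hH.trans hfin

theorem Real.two_mul_abs_sub_round_le_abs_sin (x : ℝ) :
    2 * |x - round x| ≤ |Real.sin (Real.pi * x)| := by
  have hpi := Real.pi_pos
  have h : Real.sin (Real.pi * x) = Real.sin (Real.pi * (x - round x) + round x * Real.pi) := by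
    ring_nf
  rw [h, Real.sin_add_int_mul_pi, abs_mul]
  have h1 : |((-1 : ℝ) ^ round x)| = 1 := by rw [abs_zpow]; simp
  have h2 := Real.mul_abs_le_abs_sin (x := Real.pi * (x - round x)) (by
    rw [abs_mul, abs_of_pos hpi]
    nlinarith [abs_sub_round x])
  rw [abs_mul, abs_of_pos hpi] at h2
  rw [h1, one_mul]
  refine le_of_eq_of_le ?_ h2
  field_simp

theorem Real.cos_pi_mul_pow_le {x δ : ℝ} (hδ : 0 ≤ δ) (hx : δ ≤ |x - round x|) (M : ℕ) :
    Real.cos (Real.pi * x) ^ (2 * M) ≤ Real.exp (-(4 * δ ^ 2 * M)) := by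
  have h1 : 4 * δ ^ 2 ≤ Real.sin (Real.pi * x) ^ 2 := by
    rw [← sq_abs (Real.sin _)]
    nlinarith [Real.two_mul_abs_sub_round_le_abs_sin x]
  calc Real.cos (Real.pi * x) ^ (2 * M) = (Real.cos (Real.pi * x) ^ 2) ^ M := pow_mul _ _ _
    _ ≤ Real.exp (-(4 * δ ^ 2)) ^ M := by
      gcongr
      rw [Real.cos_sq']
      linarith [Real.add_one_le_exp (-(4 * δ ^ 2))]
    _ = Real.exp (-(4 * δ ^ 2 * M)) := by rw [← Real.exp_nat_mul]; ring_nf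

open Complex in
theorem Complex.norm_sum_exp_le {a B : ℝ} (hB : 1 ≤ B * |a - round a|) (N : ℕ) :
    ‖∑ U ∈ Finset.Ioc N (2 * N), exp (2 * Real.pi * (U * a) * I)‖ ≤ B := by
  have ha : 0 < |a - round a| := by
    refine (abs_nonneg _).lt_of_ne fun h => ?_
    rw [← h, mul_zero] at hB
    linarith
  set z := exp (2 * Real.pi * a * I) with hz
  have hsum : ∑ U ∈ Finset.Ioc N (2 * N), exp (2 * Real.pi * (U * a) * I) =
      ∑ U ∈ Finset.Ico (N + 1) (2 * N + 1), z ^ U := by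
    refine Finset.sum_congr (by ext; simp) fun U _ => ?_
    rw [hz, ← Complex.exp_nat_mul]
    ring_nf
  have hz1 : ‖z‖ = 1 := by
    rw [hz]
    exact_mod_cast Complex.norm_exp_ofReal_mul_I (2 * Real.pi * a)
  have hgeom := congrArg norm (geom_sum_Ico_mul z (show N + 1 ≤ 2 * N + 1 by omega))
  have hzsub : 4 * |a - round a| ≤ ‖z - 1‖ := by
    have h := Complex.norm_exp_I_mul_ofReal_sub_one (2 * Real.pi * a)
    have h1 : z = exp (I * ((2 * Real.pi * a : ℝ) : ℂ)) := by
      rw [hz]; push_cast; ring_nf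
    rw [h1, h, Real.norm_eq_abs, abs_mul, abs_two,
      show 2 * Real.pi * a / 2 = Real.pi * a by ring]
    linarith [Real.two_mul_abs_sub_round_le_abs_sin a]
  have hle : ‖z ^ (2 * N + 1) - z ^ (N + 1)‖ ≤ 2 := by
    refine (norm_sub_le _ _).trans ?_
    rw [norm_pow, norm_pow, hz1]
    norm_num
  rw [norm_mul] at hgeom
  rw [hsum]
  have h4 : ‖∑ U ∈ Finset.Ico (N + 1) (2 * N + 1), z ^ U‖ * (4 * |a - round a|) ≤ 2 :=
    (mul_le_mul_of_nonneg_left hzsub (norm_nonneg _)).trans (hgeom.trans_le hle)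
  refine le_of_mul_le_mul_right (a := |a - round a|) ?_ ha
  linarith

open Complex in
theorem Complex.cos_pi_mul_pow_eq_sum (x : ℝ) (M : ℕ) :
    ((Real.cos (Real.pi * x) ^ (2 * M) : ℝ) : ℂ) = ∑ k ∈ Finset.range (2 * M + 1),
      (((2 * M).choose k / 4 ^ M : ℝ) : ℂ) * exp (2 * Real.pi * ((k - M) * x) * I) := by
  push_cast
  rw [Complex.cos, div_pow, pow_mul 2 2 M, add_pow, Finset.sum_div]
  refine Finset.sum_congr rfl fun k hk => ?_
  have hk : k ≤ 2 * M := Nat.lt_succ_iff.1 (Finset.mem_range.1 hk)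
  rw [← Complex.exp_nat_mul, ← Complex.exp_nat_mul, ← Complex.exp_add, Nat.cast_sub hk]
  norm_num
  rw [div_mul_eq_mul_div, mul_comm (exp _)]
  congr 3
  ring

open Complex in
theorem abs_sum_prod_cos_pow_sub_le {ι : Type*} [Fintype ι] [DecidableEq ι] (α β : ι → ℝ)
    (M : ι → ℕ) {B : ℝ} (hB₀ : 0 ≤ B) (hB : ∀ k : ι → ℤ, (∀ i, |k i| ≤ M i) → k ≠ 0 →
      1 ≤ B * |∑ i, k i * α i - round (∑ i, k i * α i)|) (N : ℕ) :
    |∑ U ∈ Finset.Ioc N (2 * N), ∏ i, Real.cos (Real.pi * (U * α i - β i)) ^ (2 * M i) -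
      N * ∏ i, ((M i).centralBinom / 4 ^ M i : ℝ)| ≤ B := by
  set P := Fintype.piFinset fun i => Finset.range (2 * M i + 1) with hP
  set w : (ι → ℕ) → ℝ := fun k => ∏ i, ((2 * M i).choose (k i) / 4 ^ M i : ℝ) with hw
  have hw₀ (k) : 0 ≤ w k := Finset.prod_nonneg fun i _ => by positivity
  have hw₁ : ∑ k ∈ P, w k = 1 := by
    rw [hw, hP]
    refine (Finset.prod_univ_sum (fun i => Finset.range (2 * M i + 1))
      (fun i j => ((2 * M i).choose j / 4 ^ M i : ℝ))).symm.trans ?_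
    refine Finset.prod_eq_one fun i _ => ?_
    rw [← Finset.sum_div, ← Nat.cast_sum, Nat.sum_range_choose, pow_mul]
    norm_num
  set e : (ι → ℕ) → (ι → ℝ) → ℝ := fun k γ => ∑ i, (((k i : ℤ) - M i : ℤ) : ℝ) * γ i with he
  set u : (ι → ℕ) → ℂ := fun k => w k * exp (2 * Real.pi * (-e k β : ℝ) * I) with hu
  have hnu (k) : ‖u k‖ = w k := by
    rw [hu, norm_mul, Complex.norm_of_nonneg (hw₀ k)]
    have := Complex.norm_exp_ofReal_mul_I (2 * Real.pi * -e k β)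
    push_cast at this ⊢
    rw [this, mul_one]
  have hexp (U : ℕ) : ((∏ i, Real.cos (Real.pi * (U * α i - β i)) ^ (2 * M i) : ℝ) : ℂ) =
      ∑ k ∈ P, u k * exp (2 * Real.pi * (U * e k α) * I) := by
    rw [ofReal_prod]
    simp_rw [Complex.cos_pi_mul_pow_eq_sum]
    rw [Finset.prod_univ_sum]
    refine Finset.sum_congr rfl fun k _ => ?_
    rw [Finset.prod_mul_distrib, ← Complex.exp_sum, hu, mul_assoc, ← Complex.exp_add, hw,
      ofReal_prod]
    congr 2
    rw [he]
    push_cast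
    rw [← add_mul, ← mul_add, ← Finset.sum_mul, ← Finset.mul_sum]
    congr 2
    rw [Finset.mul_sum, ← Finset.sum_neg_distrib, ← Finset.sum_add_distrib]
    exact Finset.sum_congr rfl fun i _ => by ring
  have hMP : M ∈ P := by
    rw [hP, Fintype.mem_piFinset]
    intro i
    rw [Finset.mem_range]
    omega
  have hM : u M = w M := by simp [hu, he]
  have hmain : ((∑ U ∈ Finset.Ioc N (2 * N), ∏ i, Real.cos (Real.pi * (U * α i - β i)) ^ (2 * M i) -
      N * ∏ i, ((M i).centralBinom / 4 ^ M i : ℝ) : ℝ) : ℂ) =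
      ∑ k ∈ P.erase M, u k * ∑ U ∈ Finset.Ioc N (2 * N), exp (2 * Real.pi * (U * e k α) * I) := by
    rw [ofReal_sub, ofReal_sum, Finset.sum_congr rfl fun U _ => hexp U, Finset.sum_comm,
      ← Finset.add_sum_erase P _ hMP, hM]
    simp_rw [← Finset.mul_sum]
    rw [add_sub_right_comm]
    convert zero_add _
    have h0 : e M α = 0 := by simp [he]
    simp [h0, hw, Nat.centralBinom, two_mul]
    ring
  rw [← Real.norm_eq_abs, ← Complex.norm_real, hmain]
  calc _ ≤ ∑ k ∈ P.erase M, w k * B := by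
        refine norm_sum_le_of_le _ fun k hk => ?_
        rw [norm_mul, hnu]
        refine mul_le_mul_of_nonneg_left (Complex.norm_sum_exp_le (hB _ (fun i => ?_) ?_) N)
          (hw₀ k)
        · have := Fintype.mem_piFinset.1 (Finset.mem_of_mem_erase hk) i
          rw [Finset.mem_range] at this
          rw [abs_le]
          omega
        · intro h
          refine Finset.ne_of_mem_erase hk (funext fun i => ?_)
          have := congrFun h i
          simp only [Pi.zero_apply] at this
          omega
    _ ≤ ∑ k ∈ P, w k * B := Finset.sum_le_sum_of_subset_of_nonneg (Finset.erase_subset _ _)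
        fun k _ _ => mul_nonneg (hw₀ k) hB₀
    _ = B := by rw [← Finset.sum_mul, hw₁, one_mul]

theorem exists_forall_abs_sub_round_le {ι : Type*} [Fintype ι] (α β : ι → ℝ)
    {M N : ℕ} {B δ : ℝ} (hM : 0 < M) (hB₀ : 0 ≤ B) (hδ : 0 ≤ δ)
    (hB : ∀ k : ι → ℤ, (∀ i, |k i| ≤ M) → k ≠ 0 →
      1 ≤ B * |∑ i, k i * α i - round (∑ i, k i * α i)|)
    (hMδ : 8 * M * Fintype.card ι * Real.exp (-(4 * δ ^ 2 * M)) ≤ 1)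
    (hN : 2 * B * (2 * M) ^ Fintype.card ι < N) :
    ∃ U ∈ Finset.Ioc N (2 * N), ∀ i, |(U * α i - β i) - round (U * α i - β i)| ≤ δ := by
  classical
  by_contra! hcon
  set η := Real.exp (-(4 * δ ^ 2 * M)) with hη
  have hη₀ : 0 < η := Real.exp_pos _
  have hM' : (0 : ℝ) < M := by exact_mod_cast hM
  set κ : ℝ := M.centralBinom / 4 ^ M with hκ
  have hκM : 1 ≤ 2 * M * κ := by
    rw [hκ, mul_div_assoc', one_le_div (by positivity)]
    exact_mod_cast Nat.four_pow_le_two_mul_self_mul_centralBinom M hM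
  have hκ₀ : 0 < κ := by
    by_contra! h
    nlinarith
  have hκ₁ : κ ≤ 1 := by
    rw [hκ, div_le_one (by positivity)]
    have h := Nat.sum_range_choose (2 * M)
    have h2 : M.centralBinom ≤ 2 ^ (2 * M) := by
      rw [← h]
      exact Finset.single_le_sum (f := fun k => (2 * M).choose k) (fun _ _ => Nat.zero_le _)
        (Finset.mem_range.2 (by omega))
    rw [pow_mul] at h2
    exact_mod_cast h2
  have hηκ : 4 * (Fintype.card ι * η) ≤ κ := by
    by_contra! h
    nlinarith
  set F : (ι → ℕ) → ℕ → ℝ := fun m U =>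
    ∏ i, Real.cos (Real.pi * (U * α i - β i)) ^ (2 * m i) with hF
  set m : ι → ι → ℕ := fun q => Function.update (fun _ => M) q 0 with hm
  have hF₀ (m U) : 0 ≤ F m U := Finset.prod_nonneg fun i _ => by rw [pow_mul]; positivity
  have hsplit (q : ι) (U : ℕ) : F (fun _ => M) U =
      Real.cos (Real.pi * (U * α q - β q)) ^ (2 * M) * F (m q) U := by
    simp only [hF]
    rw [← Finset.mul_prod_erase _ _ (Finset.mem_univ q),
      ← Finset.mul_prod_erase _ (fun i => _ ^ (2 * m q i)) (Finset.mem_univ q)]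
    simp only [hm, Function.update_self, mul_zero, pow_zero, one_mul]
    congr 1
    refine Finset.prod_congr rfl fun i hi => ?_
    rw [Function.update_of_ne (Finset.ne_of_mem_erase hi)]
  have hmean (q : ι) : κ * ∏ i, ((m q i).centralBinom / 4 ^ m q i : ℝ) = κ ^ Fintype.card ι := by
    rw [← Finset.mul_prod_erase _ _ (Finset.mem_univ q), ← Finset.card_univ, ← Finset.prod_const,
      ← Finset.mul_prod_erase _ _ (Finset.mem_univ q)]
    simp only [hm, Function.update_self, Nat.centralBinom_zero, Nat.cast_one, pow_zero, div_one,
      one_mul]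
    congr 1
    refine Finset.prod_congr rfl fun i hi => ?_
    rw [Function.update_of_ne (Finset.ne_of_mem_erase hi)]
  have hpoint (U) (hU : U ∈ Finset.Ioc N (2 * N)) : F (fun _ => M) U ≤ ∑ q, η * F (m q) U := by
    obtain ⟨q, hq⟩ := hcon U hU
    refine le_trans ?_ (Finset.single_le_sum (f := fun q => η * F (m q) U)
      (fun q _ => mul_nonneg hη₀.le (hF₀ _ _)) (Finset.mem_univ q))
    rw [hsplit q U]
    exact mul_le_mul_of_nonneg_right (Real.cos_pi_mul_pow_le hδ hq.le M) (hF₀ _ _)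
  have hlow := abs_sum_prod_cos_pow_sub_le α β (fun _ => M) hB₀ hB N
  have hup (q : ι) := abs_sum_prod_cos_pow_sub_le α β (m q) hB₀
    (fun k hk => hB k fun i => (hk i).trans (by
      by_cases h : i = q
      · subst h; simp [hm]
      · simp [hm, Function.update_of_ne h])) N
  rw [Finset.prod_const, Finset.card_univ, ← hκ] at hlow
  have hsum := Finset.sum_le_sum hpoint
  rw [Finset.sum_comm] at hsum
  simp_rw [← Finset.mul_sum] at hsum
  set c := Fintype.card ι with hc
  have hq (q : ι) : κ * ∑ U ∈ Finset.Ioc N (2 * N), F (m q) U ≤ N * κ ^ c + B := by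
    have h := (abs_le.1 (hup q)).2
    rw [← hmean q]
    simp only [hF]
    nlinarith
  have hbad : κ * ∑ q, ∑ U ∈ Finset.Ioc N (2 * N), F (m q) U ≤ c * (N * κ ^ c + B) := by
    rw [Finset.mul_sum]
    refine (Finset.sum_le_card_nsmul _ _ _ fun q _ => hq q).trans_eq ?_
    rw [nsmul_eq_mul, Finset.card_univ]
  have hBN : 2 * B < N * κ ^ c := by
    have h1 : 1 ≤ (2 * M * κ) ^ c := one_le_pow₀ hκM
    have h2 : 0 < κ ^ c := pow_pos hκ₀ c
    calc 2 * B ≤ 2 * B * (2 * M * κ) ^ c := le_mul_of_one_le_right (by positivity) h1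
      _ = 2 * B * (2 * M) ^ c * κ ^ c := by rw [mul_pow]; ring
      _ < N * κ ^ c := by gcongr
  have hlow' := (abs_le.1 hlow).1
  change -B ≤ ∑ U ∈ Finset.Ioc N (2 * N), F (fun _ => M) U - _ at hlow'
  set Z := ∑ q, ∑ U ∈ Finset.Ioc N (2 * N), F (m q) U with hZ
  have hYZ : N * κ ^ c - B ≤ η * Z := by linarith
  have h1 : κ * (4 * (η * Z)) ≤ κ * (N * κ ^ c + B) := by
    calc κ * (4 * (η * Z)) = 4 * η * (κ * Z) := by ring
      _ ≤ 4 * η * (c * (N * κ ^ c + B)) := by gcongr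
      _ = 4 * (c * η) * (N * κ ^ c + B) := by ring
      _ ≤ κ * (N * κ ^ c + B) := by gcongr
  have h2 := le_of_mul_le_mul_left h1 hκ₀
  linarith

open Filter in
theorem eventually_sqrt_approximation_parameters {ε : ℝ} (hε : 0 < ε) : ∀ᶠ T : ℝ in atTop,
    1 < T ∧ 16 * T ^ 9 ≤ Real.exp T ∧ T ≤ 4 * ε ^ 2 * T ^ 3 ∧ T ≤ T ^ 2 / Real.log T ∧
      (Nat.primeCounting ⌊T ^ 2⌋₊ : ℝ) ≤ T ^ 2 / Real.log T := by
  have hlog : 0 < 2 - Real.log 4 := by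
    rw [show (4 : ℝ) = 2 ^ 2 by norm_num, Real.log_pow]
    push_cast
    linarith [Real.log_two_lt_d9]
  filter_upwards [eventually_gt_atTop 1,
    (Real.tendsto_exp_div_pow_atTop 9).eventually_ge_atTop 16,
    ((tendsto_pow_atTop two_ne_zero).const_mul_atTop
      (show 0 < 4 * ε ^ 2 by positivity)).eventually_ge_atTop 1,
    (tendsto_pow_atTop two_ne_zero).eventually (Chebyshev.eventually_primeCounting_le hlog)]
    with T hT hexp hεT hpi
  have hT₀ : 0 < T := zero_lt_one.trans hT
  have hlogT := Real.log_pos hT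
  refine ⟨hT, (le_div_iff₀ (by positivity)).1 hexp, by nlinarith, ?_, hpi.trans_eq ?_⟩
  · rw [le_div_iff₀ hlogT, sq]
    exact mul_le_mul_of_nonneg_left ((Real.log_le_sub_one_of_pos hT₀).trans (by linarith)) hT₀.le
  · rw [Real.log_pow]
    push_cast
    field_simp
    ring


/-- For every `ε₀ ∈ (0,1)` there are `c > 0`, `T₀ ≥ 1` such that for all `T ≥ T₀`, setting
`N* = ⌊exp(exp(c T²/log T))⌋`, some integer `U ∈ (N*, 2N*]` satisfies
`‖U√q − 1/2‖ ≤ ε₀/T` simultaneously for all squarefree `q` with `1 < q ≤ T²`. -/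
theorem simultaneous_approximation_sqrt (ε₀ : ℝ) (hε₀ : 0 < ε₀) (hε₁ : ε₀ < 1) :
    ∃ c : ℝ, 0 < c ∧ ∃ T₀ : ℝ, 1 ≤ T₀ ∧ ∀ T : ℝ, T₀ ≤ T →
      ∃ U : ℕ, ⌊Real.exp (Real.exp (c * T ^ 2 / Real.log T))⌋₊ < U ∧
        U ≤ 2 * ⌊Real.exp (Real.exp (c * T ^ 2 / Real.log T))⌋₊ ∧
        ∀ q : ℕ, Squarefree q → 1 < q → (q : ℝ) ≤ T ^ 2 →
          |((U : ℝ) * Real.sqrt q - 1/2) - round ((U : ℝ) * Real.sqrt q - 1/2)| ≤ ε₀ / T := by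
  obtain ⟨T₀, hT₀⟩ := Filter.eventually_atTop.1 (eventually_sqrt_approximation_parameters hε₀)
  refine ⟨2, two_pos, max 1 T₀, le_max_left _ _, fun T hT => ?_⟩
  obtain ⟨hT1, hexp, hεT, hL, hpi⟩ := hT₀ T ((le_max_right _ _).trans hT)
  have hTpos : 0 < T := zero_lt_one.trans hT1
  rw [mul_div_assoc]
  set L := T ^ 2 / Real.log T
  set X := ⌊T ^ 2⌋₊
  have hX : (X : ℝ) ≤ T ^ 2 := Nat.floor_le (by positivity)
  set M := ⌈T ^ 5⌉₊
  have hM : T ^ 5 ≤ M := Nat.le_ceil _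
  have hM2 : (M : ℝ) ≤ 2 * T ^ 5 := by
    have h1 : (M : ℝ) < T ^ 5 + 1 := Nat.ceil_lt_add_one (by positivity)
    have h2 : 1 ≤ T ^ 5 := one_le_pow₀ hT1.le
    linarith
  have hM₀ : 0 < M := Nat.ceil_pos.2 (by positivity)
  classical
  set S := (Finset.Ioc 1 X).filter Squarefree with hSdef
  have hS : ∀ q ∈ S, Squarefree q ∧ 1 < q ∧ q ≤ X := fun q hq => by
    rw [hSdef, Finset.mem_filter, Finset.mem_Ioc] at hq
    exact ⟨hq.2, hq.1⟩
  have hcard : Fintype.card S ≤ X := by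
    rw [Fintype.card_coe]
    refine (Finset.card_filter_le _ _).trans ?_
    rw [Nat.card_Ioc]
    omega
  have hcardT : (Fintype.card S : ℝ) ≤ T ^ 2 := le_trans (by exact_mod_cast hcard) hX
  set H : ℝ := 1 + 2 * M * X ^ 2
  have hH : 1 ≤ H := le_add_of_nonneg_right (by positivity)
  set N := ⌊Real.exp (Real.exp (2 * L))⌋₊
  set B := H ^ 2 ^ Nat.primeCounting X
  have hres (k : S → ℤ) (hk : ∀ i, |k i| ≤ M) (hk0 : k ≠ 0) :
      1 ≤ B * |∑ i, k i * √((i : ℕ) : ℝ) - round (∑ i, k i * √((i : ℕ) : ℝ))| := by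
    set m : ℕ → ℤ := fun q => if h : q ∈ S then k ⟨q, h⟩ else 0 with hm
    have hmk (i : S) : m i = k i := by simp [hm]
    have hsum : ∑ i : S, (k i : ℝ) * √((i : ℕ) : ℝ) = ∑ q ∈ S, (m q : ℝ) * √(q : ℝ) := by
      rw [← Finset.sum_coe_sort S fun q => (m q : ℝ) * √(q : ℝ)]
      simp_rw [hmk]
    rw [hsum]
    refine Real.one_le_pow_mul_abs_sum_sqrt_sub_round hS (fun q hq => ?_) ?_
    · exact (hmk ⟨q, hq⟩).symm ▸ hk ⟨q, hq⟩
    · obtain ⟨i, hi⟩ := Function.ne_iff.1 hk0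
      exact ⟨i, i.2, by rw [hmk]; exact hi⟩
  have hdecay : 8 * M * Fintype.card S * Real.exp (-(4 * (ε₀ / T) ^ 2 * M)) ≤ 1 := by
    have h1 : T ≤ 4 * (ε₀ / T) ^ 2 * M := by
      calc T ≤ 4 * ε₀ ^ 2 * T ^ 3 := hεT
        _ = 4 * (ε₀ / T) ^ 2 * T ^ 5 := by field_simp
        _ ≤ 4 * (ε₀ / T) ^ 2 * M := by gcongr
    calc 8 * M * Fintype.card S * Real.exp (-(4 * (ε₀ / T) ^ 2 * M))
        ≤ 8 * (2 * T ^ 5) * T ^ 2 * Real.exp (-T) := by gcongr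
      _ = 16 * T ^ 7 * Real.exp (-T) := by ring
      _ ≤ 16 * T ^ 9 * Real.exp (-T) := by
        have := hT1.le
        gcongr
        norm_num
      _ ≤ Real.exp T * Real.exp (-T) := by gcongr
      _ = 1 := by rw [← Real.exp_add, add_neg_cancel, Real.exp_zero]
  have hlarge : 2 * B * (2 * M) ^ Fintype.card S < N := by
    have hM1 : (1 : ℝ) ≤ 2 * M := by
      have : (1 : ℝ) ≤ M := by exact_mod_cast hM₀
      linarith
    have hpow_le (x : ℝ) (hx : 0 ≤ x) (n : ℕ) : x ^ n ≤ Real.exp (n * x) := by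
      rw [Real.exp_nat_mul]
      gcongr
      linarith [Real.add_one_le_exp x]
    have htwo : (2 : ℝ) ^ Nat.primeCounting X ≤ Real.exp L := by
      calc (2 : ℝ) ^ Nat.primeCounting X ≤ Real.exp 1 ^ Nat.primeCounting X := by
            gcongr
            linarith [Real.add_one_le_exp 1]
        _ = Real.exp (Nat.primeCounting X) := Real.exp_one_pow _
        _ ≤ Real.exp L := Real.exp_le_exp.2 hpi
    have hE : 1 ≤ Real.exp L := Real.one_le_exp (hTpos.le.trans hL)
    have hpoly : 2 + H + T ^ 2 * (2 * M) ≤ Real.exp T := by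
      have h1 : H ≤ 1 + 2 * (2 * T ^ 5) * (T ^ 2) ^ 2 := by
        simp only [H]
        gcongr
      have h2 : T ^ 2 * (2 * M) ≤ T ^ 2 * (2 * (2 * T ^ 5)) := by gcongr
      have h3 : T ^ 7 ≤ T ^ 9 := pow_le_pow_right₀ hT1.le (by norm_num)
      have h4 : 1 ≤ T ^ 9 := one_le_pow₀ hT1.le
      nlinarith
    have hexponent : 2 + 2 ^ Nat.primeCounting X * H + Fintype.card S * (2 * M) ≤
        Real.exp (2 * L) := by
      calc (2 : ℝ) + 2 ^ Nat.primeCounting X * H + Fintype.card S * (2 * M)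
          ≤ Real.exp L * 2 + Real.exp L * H + Real.exp L * (T ^ 2 * (2 * M)) := by
            refine add_le_add (add_le_add (by linarith) (by gcongr)) ?_
            exact (mul_le_mul_of_nonneg_right hcardT (by positivity)).trans
              (le_mul_of_one_le_left (by positivity) hE)
        _ = Real.exp L * (2 + H + T ^ 2 * (2 * M)) := by ring
        _ ≤ Real.exp L * Real.exp L := by
            gcongr
            exact hpoly.trans (Real.exp_le_exp.2 hL)
        _ = Real.exp (2 * L) := by rw [← Real.exp_add, two_mul]
    have hP : 1 ≤ B * (2 * M : ℝ) ^ Fintype.card S :=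
      one_le_mul_of_one_le_of_one_le (one_le_pow₀ hH) (one_le_pow₀ hM1)
    have hbound : 3 * (B * (2 * M : ℝ) ^ Fintype.card S) ≤
        Real.exp (Real.exp (2 * L)) := by
      have hH' := hpow_le H (by linarith) (2 ^ Nat.primeCounting X)
      push_cast at hH'
      calc _ ≤ Real.exp 2 * (Real.exp (2 ^ Nat.primeCounting X * H) *
            Real.exp (Fintype.card S * (2 * M))) := by
            gcongr
            · linarith [Real.add_one_le_exp 2]
            · exact hpow_le _ (by linarith) _
        _ = Real.exp (2 + 2 ^ Nat.primeCounting X * H + Fintype.card S * (2 * M)) := by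
            rw [Real.exp_add, Real.exp_add, mul_assoc]
        _ ≤ _ := Real.exp_le_exp.2 hexponent
    have hN : Real.exp (Real.exp (2 * L)) < N + 1 := Nat.lt_floor_add_one _
    linarith
  obtain ⟨U, hU, hUq⟩ := exists_forall_abs_sub_round_le (fun q : S => √((q : ℕ) : ℝ))
    (fun _ => 1 / 2) hM₀ (by positivity) (by positivity) hres hdecay hlarge
  rw [Finset.mem_Ioc] at hU
  refine ⟨U, hU.1, hU.2, fun q hq hq1 hqT => hUq ⟨q, ?_⟩⟩
  rw [hSdef, Finset.mem_filter, Finset.mem_Ioc]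
  exact ⟨⟨hq1, Nat.le_floor hqT⟩, hq⟩
end

section
/- There exist constants c > 0 and T_0 ≥ 1 such that for all real T ≥ T_0, the number of pairs (h, m) of odd positive integers with T²/4 ≤ h m ≤ T²/2 and 3h < m ≤ 4h is at least c T². -/
/-- The number of pairs `(h, m)` of odd positive integers with `T²/4 ≤ hm ≤ T²/2` and
`3h < m ≤ 4h` is `≫ T²`. -/
theorem count_odd_pairs_lower_bound :
    ∃ c : ℝ, 0 < c ∧ ∃ T₀ : ℝ, 1 ≤ T₀ ∧ ∀ T : ℝ, T₀ ≤ T →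
      c * T ^ 2 ≤
        (Set.ncard {p : ℕ × ℕ | Odd p.1 ∧ Odd p.2 ∧
            T ^ 2 / 4 ≤ (p.1 * p.2 : ℝ) ∧ (p.1 * p.2 : ℝ) ≤ T ^ 2 / 2 ∧
            3 * p.1 < p.2 ∧ p.2 ≤ 4 * p.1} : ℝ) := by
  refine ⟨1 / 40000, by norm_num, 1000, by norm_num, fun T hT => ?_⟩
  set S : Set (ℕ × ℕ) := {p | Odd p.1 ∧ Odd p.2 ∧
    T ^ 2 / 4 ≤ (p.1 * p.2 : ℝ) ∧ (p.1 * p.2 : ℝ) ≤ T ^ 2 / 2 ∧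
    3 * p.1 < p.2 ∧ p.2 ≤ 4 * p.1}
  obtain ⟨N, hN⟩ : ∃ N : ℕ, N = ⌊T / 100⌋₊ := ⟨_, rfl⟩
  have hle : (N : ℝ) * 100 ≤ T := by
    have := Nat.floor_le (show 0 ≤ T / 100 by linarith)
    rw [← hN] at this
    linarith
  have hlt : T < (N + 1 : ℝ) * 100 := by
    have := Nat.lt_floor_add_one (T / 100)
    rw [← hN] at this
    linarith
  have hN10 : (10 : ℝ) ≤ N := by
    have : 10 ≤ N := hN ▸ Nat.le_floor (by push_cast; linarith)
    exact_mod_cast this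
  have hfin : S.Finite := by
    refine (Set.finite_Iic ((⌊T ^ 2 / 2⌋₊, ⌊T ^ 2 / 2⌋₊) : ℕ × ℕ)).subset ?_
    rintro ⟨h, m⟩ ⟨hh, hm, -, hub, -, -⟩
    have hub' : h * m ≤ ⌊T ^ 2 / 2⌋₊ := Nat.le_floor (by exact_mod_cast hub)
    exact ⟨(Nat.le_mul_of_pos_right h hm.pos).trans hub',
      (Nat.le_mul_of_pos_left m hh.pos).trans hub'⟩
  let f : ℕ × ℕ → ℕ × ℕ := fun q => (32 * N + 2 * q.1 + 1, 112 * N + 2 * q.2 + 1)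
  have hf : Function.Injective f := by
    rintro ⟨a, b⟩ ⟨c, d⟩ h
    simp only [f, Prod.mk.injEq] at h ⊢
    omega
  -- The image of an `N × N` box under `f` lies in `S`.
  have hsub : (((Finset.range N ×ˢ Finset.range N).image f : Finset (ℕ × ℕ)) : Set (ℕ × ℕ)) ⊆ S := by
    intro p hp
    simp only [Finset.coe_image, Set.mem_image, Finset.mem_coe, Finset.mem_product,
      Finset.mem_range] at hp
    obtain ⟨⟨i, j⟩, ⟨hi, hj⟩, rfl⟩ := hp
    dsimp only at hi hj
    have hi' : (i : ℝ) + 1 ≤ N := by exact_mod_cast hi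
    have hj' : (j : ℝ) + 1 ≤ N := by exact_mod_cast hj
    have hi0 : (0 : ℝ) ≤ i := i.cast_nonneg
    have hj0 : (0 : ℝ) ≤ j := j.cast_nonneg
    refine ⟨⟨16 * N + i, by simp only [f]; ring⟩, ⟨56 * N + j, by simp only [f]; ring⟩,
      ?_, ?_, by simp only [f]; omega, by simp only [f]; omega⟩
    · have : (32 * N : ℝ) * (112 * N) ≤ (32 * N + 2 * i + 1) * (112 * N + 2 * j + 1) := by
        gcongr <;> linarith
      simp only [f]
      push_cast
      nlinarith
    · have : (32 * N + 2 * i + 1 : ℝ) * (112 * N + 2 * j + 1) ≤ (34 * N) * (114 * N) := by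
        gcongr <;> linarith
      simp only [f]
      push_cast
      nlinarith
  have hcard : N * N ≤ S.ncard := by
    have := Set.ncard_le_ncard hsub hfin
    rwa [Set.ncard_coe_finset, Finset.card_image_of_injective _ hf, Finset.card_product,
      Finset.card_range] at this
  have hcard' : (N * N : ℝ) ≤ S.ncard := by exact_mod_cast hcard
  nlinarith
end

section
/- For every integer ℓ ≥ 1 there exist constants c > 0 and T_0 ≥ 1 such that for all real T ≥ T_0: Σ_{1 ≤ n ≤ T²/2} θ_ℓ(n) / n^{3/4} ≥ c T^{1/2}. -/
open Finset

/-- On the box `N ≤ h ≤ 2N`, `3N ≤ k ≤ 4N` the ratio `h / (2k - h)` lies in `[1/16, 1/2]`, so the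
weight is bounded below. -/
lemma weight_lower_bound (j : ℕ) {N h k : ℕ} (hN : 1 ≤ N) (h₁ : N ≤ h) (h₂ : h ≤ 2 * N)
    (k₁ : 3 * N ≤ k) (k₂ : k ≤ 4 * N) :
    1 / 4 * (1 / 2 : ℝ) ^ j ≤
      Real.sqrt ((h : ℝ) / (2 * (k : ℝ) - h)) * (1 - (h : ℝ) / (2 * (k : ℝ) - h)) ^ j := by
  have hN' : (1 : ℝ) ≤ N := by exact_mod_cast hN
  have h₁' : (N : ℝ) ≤ h := by exact_mod_cast h₁
  have h₂' : (h : ℝ) ≤ 2 * N := by exact_mod_cast h₂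
  have k₁' : 3 * (N : ℝ) ≤ k := by exact_mod_cast k₁
  have k₂' : (k : ℝ) ≤ 4 * N := by exact_mod_cast k₂
  have hpos : (0 : ℝ) < 2 * k - h := by linarith
  have hlow : (1 / 16 : ℝ) ≤ (h : ℝ) / (2 * k - h) := by
    rw [le_div_iff₀ hpos]; linarith
  have hupp : (h : ℝ) / (2 * k - h) ≤ 1 / 2 := by
    rw [div_le_iff₀ hpos]; linarith
  have hsqrt : (1 / 4 : ℝ) ≤ Real.sqrt ((h : ℝ) / (2 * k - h)) :=
    Real.le_sqrt_of_sq_le (by linarith)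
  have hpow : (1 / 2 : ℝ) ^ j ≤ (1 - (h : ℝ) / (2 * k - h)) ^ j :=
    pow_le_pow_left₀ (by norm_num) (by linarith) j
  gcongr

/-- The weights are nonnegative for `h < k`. -/
lemma weight_nonneg (j : ℕ) {h k : ℕ} (hk : h < k) :
    0 ≤ Real.sqrt ((h : ℝ) / (2 * (k : ℝ) - h)) * (1 - (h : ℝ) / (2 * (k : ℝ) - h)) ^ j := by
  have hk' : (h : ℝ) < k := by exact_mod_cast hk
  have h0 : (0 : ℝ) ≤ h := h.cast_nonneg
  have hle : (h : ℝ) / (2 * k - h) ≤ 1 := by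
    rw [div_le_one (by linarith)]; linarith
  exact mul_nonneg (Real.sqrt_nonneg _) (pow_nonneg (by linarith) j)

/-- The weighted sum `Σ_{1 ≤ n ≤ T²/2} θ_ℓ(n) n^{-3/4}` is `≫ T^{1/2}`. -/
theorem theta_sum_lower_bound (ℓ : ℕ) (hℓ : 1 ≤ ℓ) :
    ∃ c : ℝ, 0 < c ∧ ∃ T₀ : ℝ, 1 ≤ T₀ ∧ ∀ T : ℝ, T₀ ≤ T →
      c * T ^ ((1 : ℝ)/2) ≤
        ∑ n ∈ Finset.Icc 1 ⌊T ^ 2 / 2⌋₊,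
          (∑ p ∈ (Finset.Icc 1 n ×ˢ Finset.Icc 1 n).filter
                (fun p : ℕ × ℕ => p.1 < p.2 ∧ p.1 * (2 * p.2 - p.1) = n),
              Real.sqrt ((p.1 : ℝ) / (2 * (p.2 : ℝ) - p.1)) *
                (1 - (p.1 : ℝ) / (2 * (p.2 : ℝ) - p.1)) ^ (ℓ - 1))
            / (n : ℝ) ^ ((3 : ℝ)/4) := by
  set a : ℝ := 1 / 4 * (1 / 2 : ℝ) ^ (ℓ - 1)
  have ha0 : 0 < a := by positivity
  refine ⟨a / 36, by positivity, 6, by norm_num, fun T hT => ?_⟩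
  have hT0 : 0 < T := by linarith
  set N := ⌊T / 6⌋₊
  have hN : 1 ≤ N := Nat.le_floor (by push_cast; linarith)
  have hNle : (N : ℝ) ≤ T / 6 := Nat.floor_le (by positivity)
  have hNlt : T / 6 < N + 1 := Nat.lt_floor_add_one _
  set S : Finset (ℕ × ℕ) := Finset.Icc N (2 * N) ×ˢ Finset.Icc (3 * N) (4 * N) with hS
  set g : ℕ × ℕ → ℕ := fun p => p.1 * (2 * p.2 - p.1)
  have hmem : ∀ p ∈ S, N ≤ p.1 ∧ p.1 ≤ 2 * N ∧ 3 * N ≤ p.2 ∧ p.2 ≤ 4 * N := by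
    intro p hp
    simp only [hS, Finset.mem_product, Finset.mem_Icc] at hp
    tauto
  have hcard : (S.card : ℝ) = ((N : ℝ) + 1) ^ 2 := by
    have h : S.card = (N + 1) * (N + 1) := by
      rw [hS, Finset.card_product, Nat.card_Icc, Nat.card_Icc]
      congr 1 <;> omega
    rw [h]; push_cast; ring
  have hmaps : ∀ p ∈ S, g p ∈ Finset.Icc 1 ⌊T ^ 2 / 2⌋₊ := by
    intro p hp
    obtain ⟨h1, h2, h3, h4⟩ := hmem p hp
    refine Finset.mem_Icc.2 ⟨Nat.mul_pos (by omega) (by omega), Nat.le_floor ?_⟩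
    have hb : g p ≤ (2 * N) * (8 * N) := Nat.mul_le_mul h2 (by omega)
    have hb' : (g p : ℝ) ≤ (2 * N) * (8 * N) := by exact_mod_cast hb
    nlinarith [N.cast_nonneg (α := ℝ)]
  have hinner : ∀ n ∈ Finset.Icc 1 ⌊T ^ 2 / 2⌋₊,
      ((S.filter (fun p => g p = n)).card : ℝ) * (a / T ^ ((3 : ℝ) / 2)) ≤
        (∑ p ∈ (Finset.Icc 1 n ×ˢ Finset.Icc 1 n).filter
              (fun p : ℕ × ℕ => p.1 < p.2 ∧ p.1 * (2 * p.2 - p.1) = n),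
            Real.sqrt ((p.1 : ℝ) / (2 * (p.2 : ℝ) - p.1)) *
              (1 - (p.1 : ℝ) / (2 * (p.2 : ℝ) - p.1)) ^ (ℓ - 1))
          / (n : ℝ) ^ ((3 : ℝ)/4) := by
    intro n hn
    obtain ⟨hn1, hn2⟩ := Finset.mem_Icc.1 hn
    have hn0 : (0 : ℝ) < n := by exact_mod_cast hn1
    have hnT : (n : ℝ) ≤ T ^ 2 := by
      have := (Nat.le_floor_iff (by positivity)).1 hn2
      nlinarith
    have hpow : (n : ℝ) ^ ((3 : ℝ) / 4) ≤ T ^ ((3 : ℝ) / 2) := by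
      calc (n : ℝ) ^ ((3 : ℝ) / 4) ≤ (T ^ 2) ^ ((3 : ℝ) / 4) := by gcongr
        _ = T ^ ((3 : ℝ) / 2) := by
          rw [← Real.rpow_natCast, ← Real.rpow_mul hT0.le]; norm_num
    rw [← mul_div_assoc]
    refine div_le_div₀ ?_ ?_ (by positivity) hpow
    · exact Finset.sum_nonneg fun p hp => weight_nonneg _ (Finset.mem_filter.1 hp).2.1
    · rw [← nsmul_eq_mul]
      refine (Finset.card_nsmul_le_sum _ _ a fun p hp => ?_).trans
        (Finset.sum_le_sum_of_subset_of_nonneg ?_ fun p hp _ =>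
          weight_nonneg _ (Finset.mem_filter.1 hp).2.1)
      · obtain ⟨h1, h2, h3, h4⟩ := hmem p (Finset.mem_filter.1 hp).1
        exact weight_lower_bound _ hN h1 h2 h3 h4
      · intro p hp
        obtain ⟨hpS, hpn⟩ := Finset.mem_filter.1 hp
        obtain ⟨h1, h2, h3, h4⟩ := hmem p hpS
        have hle1 : p.1 ≤ n := hpn ▸ Nat.le_mul_of_pos_right _ (by omega)
        have hle2 : p.2 ≤ n :=
          hpn ▸ (show p.2 ≤ 2 * p.2 - p.1 by omega).trans (Nat.le_mul_of_pos_left _ (by omega))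
        simp only [Finset.mem_filter, Finset.mem_product, Finset.mem_Icc]
        exact ⟨⟨⟨by omega, hle1⟩, by omega, hle2⟩, by omega, hpn⟩
  refine le_trans ?_ (Finset.sum_le_sum hinner)
  rw [← Finset.sum_mul, ← Nat.cast_sum, ← Finset.card_eq_sum_card_fiberwise hmaps, hcard,
    ← mul_div_assoc, le_div_iff₀ (by positivity), mul_assoc, ← Real.rpow_add hT0]
  norm_num
  have hsq : (T / 6) ^ 2 ≤ ((N : ℝ) + 1) ^ 2 := by gcongr
  nlinarith
end

section
/- For every integer ℓ ≥ 1, the double series Σ_{h ≥ 1} Σ_{k > h} h^{−3/4} (2k − 2h)^{ℓ−1} / (2k − h)^{ℓ+3/4}, with h and k ranging over positive integers, converges (its value is a finite constant depending only on ℓ). -/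
theorem term_le_rpow_mul_rpow {x y : ℝ} (hx : 0 < x) (hxy : x < y) (n : ℕ) :
    x ^ (-(3 : ℝ)/4) * (2 * y - 2 * x) ^ n / (2 * y - x) ^ ((n : ℝ) + 7/4)
      ≤ x ^ (-(9 : ℝ)/8) * y ^ (-(11 : ℝ)/8) := by
  have hy : 0 < y := hx.trans hxy
  have hz : 0 < 2 * y - x := by linarith
  have hpow : (2 * y - 2 * x) ^ n ≤ (2 * y - x) ^ n :=
    pow_le_pow_left₀ (by linarith) (by linarith) n
  have hden : (2 * y - x) ^ n * (y ^ ((11 : ℝ)/8) * x ^ ((3 : ℝ)/8))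
      ≤ (2 * y - x) ^ ((n : ℝ) + 7/4) := by
    rw [Real.rpow_add hz, Real.rpow_natCast,
      show (7 : ℝ)/4 = 11/8 + 3/8 by norm_num, Real.rpow_add hz]
    gcongr <;> linarith
  rw [div_le_iff₀ (by positivity)]
  calc x ^ (-(3 : ℝ)/4) * (2 * y - 2 * x) ^ n
      ≤ x ^ (-(3 : ℝ)/4) * (2 * y - x) ^ n := by gcongr
    _ = x ^ (-(9 : ℝ)/8) * y ^ (-(11 : ℝ)/8)
          * ((2 * y - x) ^ n * (y ^ ((11 : ℝ)/8) * x ^ ((3 : ℝ)/8))) := by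
      have h₁ : x ^ (-(3 : ℝ)/4) = x ^ (-(9 : ℝ)/8) * x ^ ((3 : ℝ)/8) := by
        rw [← Real.rpow_add hx]; norm_num
      have h₂ : y ^ (-(11 : ℝ)/8) * y ^ ((11 : ℝ)/8) = 1 := by
        rw [← Real.rpow_add hy]; norm_num
      rw [h₁]
      linear_combination
        (-(x ^ (-(9 : ℝ)/8) * x ^ ((3 : ℝ)/8) * (2 * y - x) ^ n)) * h₂
    _ ≤ _ := by gcongr

/-- For every `ℓ ≥ 1`, the double series
`Σ_{h ≥ 1} Σ_{k > h} h^{-3/4} (2k − 2h)^{ℓ−1} / (2k − h)^{ℓ+3/4}` converges. -/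
theorem double_series_convergent (ℓ : ℕ) (hℓ : 1 ≤ ℓ) :
    Summable (fun p : ℕ × ℕ =>
      if 1 ≤ p.1 ∧ p.1 < p.2 then
        (p.1 : ℝ) ^ (-(3 : ℝ)/4) * (2 * (p.2 : ℝ) - 2 * p.1) ^ (ℓ - 1)
          / (2 * (p.2 : ℝ) - p.1) ^ ((ℓ : ℝ) + 3/4)
      else 0) := by
  have hsum : Summable (fun p : ℕ × ℕ =>
      (p.1 : ℝ) ^ (-(9 : ℝ)/8) * (p.2 : ℝ) ^ (-(11 : ℝ)/8)) :=
    (Real.summable_nat_rpow.2 (by norm_num)).mul_of_nonneg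
      (Real.summable_nat_rpow.2 (by norm_num))
      (fun _ => by positivity) (fun _ => by positivity)
  refine Summable.of_nonneg_of_le (fun p => ?_) (fun p => ?_) hsum
  · split_ifs with hp
    · have hlt : (p.1 : ℝ) < p.2 := by exact_mod_cast hp.2
      have h₁ : (0 : ℝ) ≤ 2 * (p.2 : ℝ) - 2 * p.1 := by linarith
      have h₂ : (0 : ℝ) ≤ 2 * (p.2 : ℝ) - p.1 := by
        linarith [(Nat.cast_nonneg p.1 : (0 : ℝ) ≤ p.1)]
      positivity
    · exact le_rfl
  · split_ifs with hp
    · have hpos : (0 : ℝ) < p.1 := by exact_mod_cast hp.1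
      have hlt : (p.1 : ℝ) < p.2 := by exact_mod_cast hp.2
      have hexp : (ℓ : ℝ) + 3/4 = ((ℓ - 1 : ℕ) : ℝ) + 7/4 := by
        push_cast [hℓ]; ring
      rw [hexp]
      exact term_le_rpow_mul_rpow hpos hlt (ℓ - 1)
    · positivity
end
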